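/- Fix a ψ-twisted Feynman–Kac model and bounded measurable functions φ_p : X → (0, ∞) for p = 0, …, n. Twisting the twisted potentials G_0^ψ, …, G_n^ψ (relative to the kernels M_p^ψ) by the functions φ_0, …, φ_n yields the potentials obtained by twisting the base model by the pointwise products ψ_p · φ_p: that is, (G_p^ψ)^φ(x) = G_p^{ψ·φ}(x) for every x ∈ X and p ∈ {0, …, n}. -/

import Mathlib

open MeasureTheory ProbabilityTheory ENNReal

noncomputable section

/-- A bounded, strictly positive, measurable `ℝ≥0∞`-valued function
(a potential or twisting function with values in `(0, ∞)`). -/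
def BddPos {X : Type*} [MeasurableSpace X] (f : X → ℝ≥0∞) : Prop :=
  Measurable f ∧ (∀ x, 0 < f x) ∧ ∃ C : ℝ≥0∞, C ≠ ⊤ ∧ ∀ x, f x ≤ C

/-- Predictive marginal measures `γ_p` of a Feynman–Kac model:
`γ_0 = M_0`, `γ_{p+1}(S) = ∫ γ_p(dx) G_p(x) M_{p+1}(x, S)`. -/
def fkGamma {X : Type*} [MeasurableSpace X] (M0 : Measure X)
    (M : ℕ → X → Measure X) (G : ℕ → X → ℝ≥0∞) : ℕ → Measure X
  | 0 => M0
  | p + 1 => ((fkGamma M0 M G p).withDensity (G p)).bind (M (p + 1))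

/-- Updated marginal measures `γ̂_p(S) = ∫_S G_p(x) γ_p(dx)`. -/
def fkGammaHat {X : Type*} [MeasurableSpace X] (M0 : Measure X)
    (M : ℕ → X → Measure X) (G : ℕ → X → ℝ≥0∞) (p : ℕ) : Measure X :=
  (fkGamma M0 M G p).withDensity (G p)

/-- The twist of a measure `μ` by a function `ψ` : `μ^ψ(dx) = μ(dx) ψ(x) / μ(ψ)`. -/
def fkTwist {X : Type*} [MeasurableSpace X] (μ : Measure X) (ψ : X → ℝ≥0∞) : Measure X :=
  (∫⁻ y, ψ y ∂μ)⁻¹ • μ.withDensity ψ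

/-- The `ψ`-twisted potential functions `G_p^ψ` for a model with terminal time `n`:
`G_0^ψ = (G_0/ψ_0) M_1(ψ_1) M_0(ψ_0)`, `G_p^ψ = (G_p/ψ_p) M_{p+1}(ψ_{p+1})` for
`1 ≤ p ≤ n-1`, and `G_n^ψ = G_n/ψ_n`. -/
def fkTwG {X : Type*} [MeasurableSpace X] (n : ℕ) (M0 : Measure X)
    (M : ℕ → X → Measure X) (G ψ : ℕ → X → ℝ≥0∞) (p : ℕ) (x : X) : ℝ≥0∞ :=
  G p x * (ψ p x)⁻¹ *
    (if p < n then ∫⁻ y, ψ (p + 1) y ∂(M (p + 1) x) else 1) *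
    (if p = 0 then ∫⁻ y, ψ 0 y ∂M0 else 1)

/-- Normalisation of a (finite, nonzero) measure. -/
def fkNorm {X : Type*} [MeasurableSpace X] (μ : Measure X) : Measure X :=
  (μ Set.univ)⁻¹ • μ

theorem BddPos.lintegral_ne_zero {X : Type*} [MeasurableSpace X] {f : X → ℝ≥0∞}
    (hf : BddPos f) (μ : Measure X) [NeZero μ] : ∫⁻ y, f y ∂μ ≠ 0 := by
  intro h
  rw [lintegral_eq_zero_iff hf.1] at h
  obtain ⟨x, hx⟩ := h.exists
  exact (hf.2.1 x).ne' hx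

theorem BddPos.lintegral_ne_top {X : Type*} [MeasurableSpace X] {f : X → ℝ≥0∞}
    (hf : BddPos f) (μ : Measure X) [IsFiniteMeasure μ] : ∫⁻ y, f y ∂μ ≠ ⊤ := by
  obtain ⟨C, hC, hle⟩ := hf.2.2
  refine ne_top_of_le_ne_top (ENNReal.mul_ne_top hC (measure_ne_top μ Set.univ)) ?_
  exact (lintegral_mono hle).trans_eq (lintegral_const C)

theorem BddPos.ne_top {X : Type*} [MeasurableSpace X] {f : X → ℝ≥0∞}
    (hf : BddPos f) (x : X) : f x ≠ ⊤ := by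
  obtain ⟨C, hC, hle⟩ := hf.2.2
  exact ne_top_of_le_ne_top hC (hle x)

theorem lintegral_mul_lintegral_fkTwist {X : Type*} [MeasurableSpace X]
    (μ : Measure X) [IsProbabilityMeasure μ] {ψ φ : X → ℝ≥0∞}
    (hψ : BddPos ψ) (hφ : Measurable φ) :
    (∫⁻ y, ψ y ∂μ) * ∫⁻ y, φ y ∂(fkTwist μ ψ) = ∫⁻ y, ψ y * φ y ∂μ := by
  rw [fkTwist, lintegral_smul_measure, lintegral_withDensity_eq_lintegral_mul _ hψ.1 hφ,
    smul_eq_mul, ← mul_assoc,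
    ENNReal.mul_inv_cancel (hψ.lintegral_ne_zero μ) (hψ.lintegral_ne_top μ), one_mul]
  rfl

theorem twist_of_twist_potentials {X : Type*} [MeasurableSpace X] (n : ℕ)
    (M0 : Measure X) [IsProbabilityMeasure M0]
    (M : ℕ → Kernel X X) [∀ p, IsMarkovKernel (M p)]
    (G ψ φ : ℕ → X → ℝ≥0∞)
    (hG : ∀ p ≤ n, BddPos (G p))
    (hψ : ∀ p ≤ n, BddPos (ψ p)) (hφ : ∀ p ≤ n, BddPos (φ p)) :
    ∀ p ≤ n, ∀ x : X,
      fkTwG n (fkTwist M0 (ψ 0)) (fun q x => fkTwist (M q x) (ψ q))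
          (fkTwG n M0 (fun q x => M q x) G ψ) φ p x
        = fkTwG n M0 (fun q x => M q x) G (fun q y => ψ q y * φ q y) p x := by
  intro p hp x
  have h₀ := lintegral_mul_lintegral_fkTwist M0 (hψ 0 n.zero_le) (hφ 0 n.zero_le).1
  have hinv : (ψ p x * φ p x)⁻¹ = (ψ p x)⁻¹ * (φ p x)⁻¹ :=
    ENNReal.mul_inv (.inl ((hψ p hp).2.1 x).ne') (.inl ((hψ p hp).ne_top x))
  have hinit : (if p = 0 then ∫⁻ y, ψ 0 y * φ 0 y ∂M0 else 1)
      = (if p = 0 then ∫⁻ y, ψ 0 y ∂M0 else 1) *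
        (if p = 0 then ∫⁻ y, φ 0 y ∂(fkTwist M0 (ψ 0)) else 1) := by
    split_ifs <;> simp [h₀]
  have hnext : (if p < n then ∫⁻ y, ψ (p + 1) y * φ (p + 1) y ∂(M (p + 1) x) else 1)
      = (if p < n then ∫⁻ y, ψ (p + 1) y ∂(M (p + 1) x) else 1) *
        (if p < n then ∫⁻ y, φ (p + 1) y ∂(fkTwist (M (p + 1) x) (ψ (p + 1))) else 1) := by
    split_ifs with h
    · exact (lintegral_mul_lintegral_fkTwist (M (p + 1) x) (hψ _ h) (hφ _ h).1).symm
    · simp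
  simp only [fkTwG]
  rw [hinv, hinit, hnext]
  ring

end
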